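/- Let Λ be a finite-dimensional algebra over a field K. Every finitely generated torsion class in mod Λ is widely generated, and the mutually inverse bijections T ↦ MCE(T^⊥) and S ↦ T(S) between widely generated torsion classes and semibricks restrict to mutually inverse bijections between the set of finitely generated torsion classes in mod Λ and the set of finite semibricks in mod Λ. -/

import Mathlib

open Function DirectSum

namespace BrickPaper

variable (Λ : Type) [Ring Λ]

/-- `M` belongs to `mod Λ`, i.e. is a finitely generated module. -/
abbrev FG (M : ModuleCat.{0} Λ) : Prop := Module.Finite Λ M

/-- A class of modules closed under isomorphism. -/
def IsoClosed (C : Set (ModuleCat.{0} Λ)) : Prop :=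
  ∀ ⦃M N : ModuleCat.{0} Λ⦄, Nonempty (M ≃ₗ[Λ] N) → M ∈ C → N ∈ C

/-- A class of modules containing the zero modules. -/
def HasZeroObj (C : Set (ModuleCat.{0} Λ)) : Prop :=
  ∀ M : ModuleCat.{0} Λ, Subsingleton M → M ∈ C

/-- Closure under extensions: if `0 → A → M → B → 0` is exact with `A, B ∈ C` then `M ∈ C`. -/
def ExtClosed (C : Set (ModuleCat.{0} Λ)) : Prop :=
  ∀ ⦃A M B : ModuleCat.{0} Λ⦄ (f : A →ₗ[Λ] M) (g : M →ₗ[Λ] B),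
    Function.Injective f → Function.Surjective g →
    LinearMap.range f = LinearMap.ker g → A ∈ C → B ∈ C → M ∈ C

/-- Closure under quotients (images of surjections). -/
def QuotClosed (C : Set (ModuleCat.{0} Λ)) : Prop :=
  ∀ ⦃M N : ModuleCat.{0} Λ⦄ (g : M →ₗ[Λ] N), Function.Surjective g → M ∈ C → N ∈ C

/-- Closure under submodules (sources of injections). -/
def SubClosed (C : Set (ModuleCat.{0} Λ)) : Prop :=
  ∀ ⦃M N : ModuleCat.{0} Λ⦄ (f : M →ₗ[Λ] N), Function.Injective f → N ∈ C → M ∈ C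

/-- Closure under kernels of morphisms between members. -/
def KerClosed (C : Set (ModuleCat.{0} Λ)) : Prop :=
  ∀ ⦃M N : ModuleCat.{0} Λ⦄ (f : M →ₗ[Λ] N), M ∈ C → N ∈ C →
    ModuleCat.of Λ ↥(LinearMap.ker f) ∈ C

/-- Closure under cokernels of morphisms between members. -/
def CokerClosed (C : Set (ModuleCat.{0} Λ)) : Prop :=
  ∀ ⦃M N : ModuleCat.{0} Λ⦄ (f : M →ₗ[Λ] N), M ∈ C → N ∈ C →
    ModuleCat.of Λ ((N : Type) ⧸ LinearMap.range f) ∈ C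

/-- A wide subcategory of `mod Λ`: a class of finitely generated modules, closed under
isomorphisms, containing `0`, and closed under kernels, cokernels and extensions. -/
def IsWide (C : Set (ModuleCat.{0} Λ)) : Prop :=
  (∀ M ∈ C, FG Λ M) ∧ IsoClosed Λ C ∧ HasZeroObj Λ C ∧
    KerClosed Λ C ∧ CokerClosed Λ C ∧ ExtClosed Λ C

/-- A wide subcategory of the big module category `Mod Λ` (no finiteness condition). -/
def IsWideBig (C : Set (ModuleCat.{0} Λ)) : Prop :=
  IsoClosed Λ C ∧ HasZeroObj Λ C ∧ KerClosed Λ C ∧ CokerClosed Λ C ∧ ExtClosed Λ C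

/-- A torsion class in `mod Λ`: closed under quotients and extensions. -/
def IsTorsionClass (C : Set (ModuleCat.{0} Λ)) : Prop :=
  (∀ M ∈ C, FG Λ M) ∧ IsoClosed Λ C ∧ HasZeroObj Λ C ∧ QuotClosed Λ C ∧ ExtClosed Λ C

/-- A torsion-free class in `mod Λ`: closed under submodules and extensions. -/
def IsTorsionFreeClass (C : Set (ModuleCat.{0} Λ)) : Prop :=
  (∀ M ∈ C, FG Λ M) ∧ IsoClosed Λ C ∧ HasZeroObj Λ C ∧ SubClosed Λ C ∧ ExtClosed Λ C

/-- The smallest torsion class containing `X`. -/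
def torsClosure (X : Set (ModuleCat.{0} Λ)) : Set (ModuleCat.{0} Λ) :=
  ⋂₀ {C | IsTorsionClass Λ C ∧ X ⊆ C}

/-- The smallest torsion-free class containing `X`. -/
def torfClosure (X : Set (ModuleCat.{0} Λ)) : Set (ModuleCat.{0} Λ) :=
  ⋂₀ {C | IsTorsionFreeClass Λ C ∧ X ⊆ C}

/-- A widely generated torsion class. -/
def IsWidelyGenTors (T : Set (ModuleCat.{0} Λ)) : Prop :=
  IsTorsionClass Λ T ∧ ∃ W, IsWide Λ W ∧ T = torsClosure Λ W

/-- A widely generated torsion-free class. -/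
def IsWidelyGenTorf (F : Set (ModuleCat.{0} Λ)) : Prop :=
  IsTorsionFreeClass Λ F ∧ ∃ W, IsWide Λ W ∧ F = torfClosure Λ W

/-- A finitely generated torsion class: generated by a single module of `mod Λ`. -/
def IsFinGenTors (T : Set (ModuleCat.{0} Λ)) : Prop :=
  IsTorsionClass Λ T ∧ ∃ M : ModuleCat.{0} Λ, FG Λ M ∧ T = torsClosure Λ {M}

/-- `T' ` covers `T` in the poset of torsion classes. -/
def TorsCovers (T' T : Set (ModuleCat.{0} Λ)) : Prop :=
  IsTorsionClass Λ T' ∧ T ⊂ T' ∧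
    ∀ T'', IsTorsionClass Λ T'' → T ⊂ T'' → T'' ⊆ T' → T'' = T'

/-- `F'` covers `F` in the poset of torsion-free classes. -/
def TorfCovers (F' F : Set (ModuleCat.{0} Λ)) : Prop :=
  IsTorsionFreeClass Λ F' ∧ F ⊂ F' ∧
    ∀ F'', IsTorsionFreeClass Λ F'' → F ⊂ F'' → F'' ⊆ F' → F'' = F'

/-- A brick: a finitely generated module whose endomorphism ring is a division ring. -/
def IsBrick (M : ModuleCat.{0} Λ) : Prop :=
  FG Λ M ∧ Nontrivial M ∧ ∀ f : M →ₗ[Λ] M, f ≠ 0 → Function.Bijective f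

/-- A semibrick, regarded as an isomorphism-closed class of bricks (i.e. a set of
isomorphism classes of bricks) which are pairwise Hom-orthogonal. -/
def IsSemibrick (S : Set (ModuleCat.{0} Λ)) : Prop :=
  (∀ M ∈ S, IsBrick Λ M) ∧ IsoClosed Λ S ∧
    ∀ M ∈ S, ∀ N ∈ S, IsEmpty (M ≃ₗ[Λ] N) → ∀ f : M →ₗ[Λ] N, f = 0

/-- A monobrick, regarded as an isomorphism-closed class of bricks (i.e. a set of
isomorphism classes of bricks) such that every morphism between members is zero or injective. -/
def IsMonobrick (S : Set (ModuleCat.{0} Λ)) : Prop :=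
  (∀ M ∈ S, IsBrick Λ M) ∧ IsoClosed Λ S ∧
    ∀ M ∈ S, ∀ N ∈ S, ∀ f : M →ₗ[Λ] N, f = 0 ∨ Function.Injective f

/-- `N` is a cofinal extension of the monobrick `M`. -/
def IsCofinalExtension (M N : Set (ModuleCat.{0} Λ)) : Prop :=
  IsMonobrick Λ N ∧ M ⊆ N ∧
    ∀ X ∈ N, ∃ Y ∈ M, ∃ f : X →ₗ[Λ] Y, Function.Injective f

/-- A cofinally closed monobrick: a monobrick with no proper cofinal extension. -/
def IsCofinallyClosed (M : Set (ModuleCat.{0} Λ)) : Prop :=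
  IsMonobrick Λ M ∧ ∀ N, IsCofinalExtension Λ M N → N = M

/-- `S` contains only finitely many modules up to isomorphism. -/
def FiniteUpToIso (S : Set (ModuleCat.{0} Λ)) : Prop :=
  ∃ B : Set (ModuleCat.{0} Λ), B.Finite ∧ ∀ M ∈ S, ∃ N ∈ B, Nonempty (M ≃ₗ[Λ] N)

/-- `Λ` is brick-finite: there are only finitely many bricks up to isomorphism. -/
def BrickFinite : Prop := FiniteUpToIso Λ {M | IsBrick Λ M}

/-- Right Hom-perpendicular class `T^⊥` inside `mod Λ`. -/
def rPerp (T : Set (ModuleCat.{0} Λ)) : Set (ModuleCat.{0} Λ) :=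
  {M | FG Λ M ∧ ∀ X ∈ T, ∀ f : X →ₗ[Λ] M, f = 0}

/-- Left Hom-perpendicular class `^⊥F` inside `mod Λ`. -/
def lPerp (F : Set (ModuleCat.{0} Λ)) : Set (ModuleCat.{0} Λ) :=
  {M | FG Λ M ∧ ∀ Y ∈ F, ∀ f : M →ₗ[Λ] Y, f = 0}

/-- A minimal extending module for a torsion class `T`. -/
def IsMinExt (T : Set (ModuleCat.{0} Λ)) (M : ModuleCat.{0} Λ) : Prop :=
  FG Λ M ∧ Nontrivial M ∧
    (∀ S : Submodule Λ M, S ≠ ⊥ → ModuleCat.of Λ ((M : Type) ⧸ S) ∈ T) ∧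
    (∀ (X T' : ModuleCat.{0} Λ) (f : M →ₗ[Λ] X) (g : X →ₗ[Λ] T'),
      Function.Injective f → Function.Surjective g →
      LinearMap.range f = LinearMap.ker g → T' ∈ T →
      (¬ ∃ r : X →ₗ[Λ] M, r ∘ₗ f = LinearMap.id) → X ∈ T) ∧
    (∀ X ∈ T, ∀ f : X →ₗ[Λ] M, f = 0)

/-- A minimal co-extending module for a torsion-free class `F`. -/
def IsMinCoext (F : Set (ModuleCat.{0} Λ)) (M : ModuleCat.{0} Λ) : Prop :=
  FG Λ M ∧ Nontrivial M ∧
    (∀ S : Submodule Λ M, S ≠ ⊤ → ModuleCat.of Λ ↥S ∈ F) ∧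
    (∀ (X F' : ModuleCat.{0} Λ) (f : F' →ₗ[Λ] X) (g : X →ₗ[Λ] M),
      Function.Injective f → Function.Surjective g →
      LinearMap.range f = LinearMap.ker g → F' ∈ F →
      (¬ ∃ s : M →ₗ[Λ] X, g ∘ₗ s = LinearMap.id) → X ∈ F) ∧
    (∀ Y ∈ F, ∀ f : M →ₗ[Λ] Y, f = 0)

/-- The set (of representatives of isomorphism classes) of minimal extending modules. -/
def ME (T : Set (ModuleCat.{0} Λ)) : Set (ModuleCat.{0} Λ) := {M | IsMinExt Λ T M}

/-- The set (of representatives of isomorphism classes) of minimal co-extending modules. -/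
def MCE (F : Set (ModuleCat.{0} Λ)) : Set (ModuleCat.{0} Λ) := {M | IsMinCoext Λ F M}

/-- `M` admits a finite filtration with subquotients isomorphic to members of `B`. -/
def FiltMem (B : Set (ModuleCat.{0} Λ)) (M : ModuleCat.{0} Λ) : Prop :=
  ∃ (n : ℕ) (c : Fin (n + 1) → Submodule Λ M), Monotone c ∧ c 0 = ⊥ ∧ c (Fin.last n) = ⊤ ∧
    ∀ i : Fin n, ∃ N ∈ B,
      Nonempty ((↥(c i.succ) ⧸ Submodule.comap (c i.succ).subtype (c i.castSucc)) ≃ₗ[Λ] N)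

/-- `Filt B`. -/
def filtClosure (B : Set (ModuleCat.{0} Λ)) : Set (ModuleCat.{0} Λ) :=
  {M | FiltMem Λ B M}

/-- The simple objects of a subcategory `C`, i.e. nonzero members with no proper nonzero
subobject belonging to `C`. -/
def simOf (C : Set (ModuleCat.{0} Λ)) : Set (ModuleCat.{0} Λ) :=
  {M | M ∈ C ∧ Nontrivial M ∧
    ∀ (X : ModuleCat.{0} Λ) (f : X →ₗ[Λ] M), X ∈ C → Function.Injective f →
      LinearMap.range f = ⊥ ∨ LinearMap.range f = ⊤}

/-- The subcategory `α(T) = {X ∈ T : for all g : Y → X with Y ∈ T, ker g ∈ T}`. -/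
def alphaOf (T : Set (ModuleCat.{0} Λ)) : Set (ModuleCat.{0} Λ) :=
  {X | X ∈ T ∧ ∀ (Y : ModuleCat.{0} Λ) (g : Y →ₗ[Λ] X), Y ∈ T →
    ModuleCat.of Λ ↥(LinearMap.ker g) ∈ T}

/-- Covariantly finite subcategory of `mod Λ`. -/
def CovariantlyFinite (B : Set (ModuleCat.{0} Λ)) : Prop :=
  ∀ M : ModuleCat.{0} Λ, FG Λ M → ∃ N ∈ B, ∃ f : M →ₗ[Λ] N,
    ∀ N' ∈ B, ∀ g : M →ₗ[Λ] N', ∃ h : N →ₗ[Λ] N', h ∘ₗ f = g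

/-- Contravariantly finite subcategory of `mod Λ`. -/
def ContravariantlyFinite (B : Set (ModuleCat.{0} Λ)) : Prop :=
  ∀ M : ModuleCat.{0} Λ, FG Λ M → ∃ N ∈ B, ∃ f : N →ₗ[Λ] M,
    ∀ N' ∈ B, ∀ g : N' →ₗ[Λ] M, ∃ h : N' →ₗ[Λ] N, f ∘ₗ h = g

/-- Functorially finite subcategory of `mod Λ`. -/
def FunctoriallyFinite (B : Set (ModuleCat.{0} Λ)) : Prop :=
  CovariantlyFinite Λ B ∧ ContravariantlyFinite Λ B

/-- Closure under (set-indexed) coproducts. -/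
def CoprodClosed (C : Set (ModuleCat.{0} Λ)) : Prop :=
  ∀ (ι : Type) (M : ι → ModuleCat.{0} Λ), (∀ i, M i ∈ C) →
    ModuleCat.of Λ (⨁ i, (M i : Type)) ∈ C

/-- Closure under (set-indexed) products. -/
def ProdClosed (C : Set (ModuleCat.{0} Λ)) : Prop :=
  ∀ (ι : Type) (M : ι → ModuleCat.{0} Λ), (∀ i, M i ∈ C) →
    ModuleCat.of Λ ((i : ι) → (M i : Type)) ∈ C

/-! Lattice-theoretic notions in the complete lattice of torsion classes. -/

/-- The join of a set of torsion classes. -/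
def torsJoin (X : Set (Set (ModuleCat.{0} Λ))) : Set (ModuleCat.{0} Λ) :=
  torsClosure Λ (⋃₀ X)

/-- The meet of a set of torsion classes (inside the lattice of torsion classes,
whose top element is `mod Λ`). -/
def torsMeet (X : Set (Set (ModuleCat.{0} Λ))) : Set (ModuleCat.{0} Λ) :=
  {M | FG Λ M} ∩ ⋂₀ X

/-- A completely join-irreducible torsion class. -/
def CompletelyJoinIrred (J : Set (ModuleCat.{0} Λ)) : Prop :=
  IsTorsionClass Λ J ∧
    ∀ X : Set (Set (ModuleCat.{0} Λ)), (∀ a ∈ X, IsTorsionClass Λ a) →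
      torsJoin Λ X = J → J ∈ X

/-- `J_* = ⋁ {x : x < J}`. -/
def jstar (J : Set (ModuleCat.{0} Λ)) : Set (ModuleCat.{0} Λ) :=
  torsJoin Λ {C | IsTorsionClass Λ C ∧ C ⊂ J}

/-- `k = κ(J) = max {x : J ∧ x = J_*}`. -/
def IsKappa (J k : Set (ModuleCat.{0} Λ)) : Prop :=
  IsTorsionClass Λ k ∧ J ∩ k = jstar Λ J ∧
    ∀ C, IsTorsionClass Λ C → J ∩ C = jstar Λ J → C ⊆ k

/-- `A` is a join representation of the torsion class `T`. -/
def IsJoinRep (T : Set (ModuleCat.{0} Λ)) (A : Set (Set (ModuleCat.{0} Λ))) : Prop :=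
  (∀ a ∈ A, IsTorsionClass Λ a) ∧ torsJoin Λ A = T

/-- `A` refines `B`. -/
def Refines (A B : Set (Set (ModuleCat.{0} Λ))) : Prop :=
  ∀ a ∈ A, ∃ b ∈ B, a ⊆ b

/-- `A` is the canonical join representation of `T`. -/
def IsCJR (T : Set (ModuleCat.{0} Λ)) (A : Set (Set (ModuleCat.{0} Λ))) : Prop :=
  IsJoinRep Λ T A ∧ (∀ B, IsJoinRep Λ T B → Refines Λ A B) ∧
    ∀ a ∈ A, ∀ b ∈ A, a ⊆ b → a = b

/-- `Kb = κ̄(T) = ⋀ {κ(j) : j ∈ CJR(T)}`, the extended kappa map. -/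
def IsKappaBar (T Kb : Set (ModuleCat.{0} Λ)) : Prop :=
  ∃ A, IsCJR Λ T A ∧ (∀ j ∈ A, CompletelyJoinIrred Λ j) ∧
    (∀ j ∈ A, ∃ k, IsKappa Λ j k) ∧
    Kb = torsMeet Λ {k | ∃ j ∈ A, IsKappa Λ j k}

/-- The kappa order: `a ≤_κ b` iff `a ≤ b` and `κ̄(a) ≥ κ̄(b)`. -/
def KappaLE (a b : Set (ModuleCat.{0} Λ)) : Prop :=
  a ⊆ b ∧ ∀ Ka Kb, IsKappaBar Λ a Ka → IsKappaBar Λ b Kb → Kb ⊆ Ka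

section TorsionClasses

variable {Λ}

theorem exists_comp_eq_of_ker_le {A B C : Type} [AddCommGroup A] [AddCommGroup B] [AddCommGroup C]
    [Module Λ A] [Module Λ B] [Module Λ C] {g : A →ₗ[Λ] B} (hg : Surjective g) {h : A →ₗ[Λ] C}
    (hk : LinearMap.ker g ≤ LinearMap.ker h) : ∃ k : B →ₗ[Λ] C, k ∘ₗ g = h := by
  refine ⟨(LinearMap.ker g).liftQ h hk ∘ₗ (g.quotKerEquivOfSurjective hg).symm.toLinearMap, ?_⟩
  ext x
  have : (g.quotKerEquivOfSurjective hg).symm (g x) = Submodule.Quotient.mk x := by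
    rw [LinearEquiv.symm_apply_eq]; rfl
  simp [this]

theorem exists_comp_eq_of_range_le {A B C : Type} [AddCommGroup A] [AddCommGroup B]
    [AddCommGroup C] [Module Λ A] [Module Λ B] [Module Λ C] {f : A →ₗ[Λ] B} (hf : Injective f)
    {h : C →ₗ[Λ] B} (hr : LinearMap.range h ≤ LinearMap.range f) :
    ∃ k : C →ₗ[Λ] A, f ∘ₗ k = h := by
  refine ⟨(LinearEquiv.ofInjective f hf).symm.toLinearMap ∘ₗ
    h.codRestrict (LinearMap.range f) fun c => hr ⟨c, rfl⟩, ?_⟩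
  ext x
  exact congrArg Subtype.val
    ((LinearEquiv.ofInjective f hf).apply_symm_apply ⟨h x, hr ⟨x, rfl⟩⟩)

theorem exists_retraction_of_section {A X B : Type} [AddCommGroup A] [AddCommGroup X]
    [AddCommGroup B] [Module Λ A] [Module Λ X] [Module Λ B] {f : A →ₗ[Λ] X} {g : X →ₗ[Λ] B}
    (hf : Injective f) (hfg : LinearMap.range f = LinearMap.ker g) {s : B →ₗ[Λ] X}
    (hs : g ∘ₗ s = LinearMap.id) : ∃ r : X →ₗ[Λ] A, r ∘ₗ f = LinearMap.id := by
  obtain ⟨r, hr⟩ := exists_comp_eq_of_range_le hf (h := LinearMap.id - s ∘ₗ g) (by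
    rw [hfg]
    rintro _ ⟨x, rfl⟩
    have : g (s (g x)) = g x := LinearMap.congr_fun hs (g x)
    simp [this])
  refine ⟨r, LinearMap.ext fun a => hf ?_⟩
  have h1 := LinearMap.congr_fun hr (f a)
  have h2 : g (f a) = 0 := by
    rw [← LinearMap.mem_ker, ← hfg]; exact ⟨a, rfl⟩
  simpa [h2] using h1

variable {C : Set (ModuleCat.{0} Λ)}

namespace IsTorsionClass

theorem finite (hC : IsTorsionClass Λ C) {M : ModuleCat.{0} Λ} (hM : M ∈ C) :
    Module.Finite Λ M := hC.1 M hM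

theorem of_surjective (hC : IsTorsionClass Λ C) {M N : ModuleCat.{0} Λ} (hM : M ∈ C)
    (g : M →ₗ[Λ] N) (hg : Surjective g) : N ∈ C := hC.2.2.2.1 g hg hM

theorem range_mem (hC : IsTorsionClass Λ C) {M N : ModuleCat.{0} Λ} (hM : M ∈ C)
    (g : M →ₗ[Λ] N) : ModuleCat.of Λ ↥(LinearMap.range g) ∈ C :=
  hC.of_surjective (N := ModuleCat.of Λ ↥(LinearMap.range g)) hM g.rangeRestrict
    g.surjective_rangeRestrict

theorem ext_mem (hC : IsTorsionClass Λ C) {A M B : ModuleCat.{0} Λ} (hA : A ∈ C) (hB : B ∈ C)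
    (f : A →ₗ[Λ] M) (g : M →ₗ[Λ] B) (hf : Injective f) (hg : Surjective g)
    (hfg : LinearMap.range f = LinearMap.ker g) : M ∈ C := hC.2.2.2.2 f g hf hg hfg hA hB

theorem prod_mem (hC : IsTorsionClass Λ C) {M N : ModuleCat.{0} Λ} (hM : M ∈ C) (hN : N ∈ C) :
    ModuleCat.of Λ (M × N) ∈ C :=
  hC.ext_mem (M := ModuleCat.of Λ (M × N)) hM hN (LinearMap.inl Λ M N) (LinearMap.snd Λ M N)
    LinearMap.inl_injective Prod.snd_surjective (LinearMap.range_inl Λ M N)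

end IsTorsionClass

theorem isTorsionClass_finite : IsTorsionClass Λ {M | FG Λ M} := by
  refine ⟨fun _ h => h, ?_, ?_, ?_, ?_⟩
  · rintro M N ⟨e⟩ (h : Module.Finite Λ M)
    exact Module.Finite.equiv e
  · intro M h
    exact (inferInstance : Module.Finite Λ M)
  · intro M N g hg (h : Module.Finite Λ M)
    exact Module.Finite.of_surjective g hg
  · intro A M B f g hf hg hfg (hA : Module.Finite Λ A) (hB : Module.Finite Λ B)
    exact Module.Finite.of_exact (LinearMap.exact_iff.2 hfg.symm) hg

theorem isTorsionClass_lPerp (F : Set (ModuleCat.{0} Λ)) : IsTorsionClass Λ (lPerp Λ F) := by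
  have hT := isTorsionClass_finite (Λ := Λ)
  have hq : QuotClosed Λ (lPerp Λ F) := by
    intro M N g hg hM
    refine ⟨hT.of_surjective hM.1 g hg, fun Y hY f => ?_⟩
    have := hM.2 Y hY (f ∘ₗ g)
    exact LinearMap.ext fun x => by
      obtain ⟨y, rfl⟩ := hg x
      exact LinearMap.congr_fun this y
  refine ⟨fun M h => h.1, ?_, ?_, hq, ?_⟩
  · rintro M N ⟨e⟩ hM
    exact hq e.toLinearMap e.surjective hM
  · intro M h
    exact ⟨hT.2.2.1 M h, fun Y _ f => LinearMap.ext fun x => by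
      rw [Subsingleton.elim x 0, map_zero, map_zero]⟩
  · intro A M B f g hf hg hfg hA hB
    refine ⟨hT.ext_mem hA.1 hB.1 f g hf hg hfg, fun Y hY h => ?_⟩
    obtain ⟨k, rfl⟩ := exists_comp_eq_of_ker_le hg (h := h) (by
      rw [← hfg]
      rintro _ ⟨a, rfl⟩
      exact LinearMap.congr_fun (hA.2 Y hY (h ∘ₗ f)) a)
    rw [hB.2 Y hY k, LinearMap.zero_comp]

theorem subset_torsClosure (X : Set (ModuleCat.{0} Λ)) : X ⊆ torsClosure Λ X :=
  fun _ hM _ hC => hC.2 hM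

theorem torsClosure_subset (hC : IsTorsionClass Λ C) {X : Set (ModuleCat.{0} Λ)} (h : X ⊆ C) :
    torsClosure Λ X ⊆ C := fun _ hM => hM C ⟨hC, h⟩

theorem torsClosure_mono {X Y : Set (ModuleCat.{0} Λ)} (h : X ⊆ Y) :
    torsClosure Λ X ⊆ torsClosure Λ Y := fun _ hM D hD => hM D ⟨hD.1, h.trans hD.2⟩

theorem isTorsionClass_torsClosure {X : Set (ModuleCat.{0} Λ)} (hX : ∀ M ∈ X, FG Λ M) :
    IsTorsionClass Λ (torsClosure Λ X) := by
  refine ⟨torsClosure_subset isTorsionClass_finite hX, ?_, ?_, ?_, ?_⟩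
  · exact fun M N e hM D hD => hD.1.2.1 e (hM D hD)
  · exact fun M h D hD => hD.1.2.2.1 M h
  · exact fun M N g hg hM D hD => hD.1.of_surjective (hM D hD) g hg
  · exact fun A M B f g hf hg hfg hA hB D hD => hD.1.ext_mem (hA D hD) (hB D hD) f g hf hg hfg

theorem torsClosure_eq_of_subset {X Y : Set (ModuleCat.{0} Λ)} (hX : ∀ M ∈ X, FG Λ M)
    (hY : ∀ M ∈ Y, FG Λ M) (h : X ⊆ torsClosure Λ Y) (h' : Y ⊆ torsClosure Λ X) :
    torsClosure Λ X = torsClosure Λ Y :=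
  (torsClosure_subset (isTorsionClass_torsClosure hY) h).antisymm
    (torsClosure_subset (isTorsionClass_torsClosure hX) h')

theorem rPerp_torsClosure {X : Set (ModuleCat.{0} Λ)} (hX : ∀ M ∈ X, FG Λ M) :
    rPerp Λ (torsClosure Λ X) = rPerp Λ X := by
  refine Set.Subset.antisymm (fun N hN => ⟨hN.1, fun M hM => hN.2 M (subset_torsClosure X hM)⟩)
    fun N hN => ⟨hN.1, fun M hM f => ?_⟩
  exact (torsClosure_subset (isTorsionClass_lPerp (rPerp Λ X))
    (fun Y hY => ⟨hX Y hY, fun Z hZ g => hZ.2 Y hY g⟩) hM).2 N hN f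

theorem isTorsionClass_sUnion {c : Set (Set (ModuleCat.{0} Λ))}
    (hc : ∀ D ∈ c, IsTorsionClass Λ D) (hd : DirectedOn (· ⊆ ·) c) (hne : c.Nonempty) :
    IsTorsionClass Λ (⋃₀ c) := by
  refine ⟨?_, ?_, ?_, ?_, ?_⟩
  · rintro M ⟨D, hD, hM⟩
    exact (hc D hD).finite hM
  · rintro M N e ⟨D, hD, hM⟩
    exact ⟨D, hD, (hc D hD).2.1 e hM⟩
  · obtain ⟨D, hD⟩ := hne
    exact fun M h => ⟨D, hD, (hc D hD).2.2.1 M h⟩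
  · rintro M N g hg ⟨D, hD, hM⟩
    exact ⟨D, hD, (hc D hD).of_surjective hM g hg⟩
  · rintro A M B f g hf hg hfg ⟨D, hD, hA⟩ ⟨E, hE, hB⟩
    obtain ⟨G, hG, hDG, hEG⟩ := hd D hD E hE
    exact ⟨G, hG, (hc G hG).ext_mem (hDG hA) (hEG hB) f g hf hg hfg⟩

theorem rPerp_of_injective [IsNoetherianRing Λ] {M N : ModuleCat.{0} Λ} (hN : N ∈ rPerp Λ C)
    (f : M →ₗ[Λ] N) (hf : Injective f) : M ∈ rPerp Λ C := by
  have : Module.Finite Λ N := hN.1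
  refine ⟨Module.Finite.of_injective f hf, fun X hX g => LinearMap.ext fun x => hf ?_⟩
  simpa using LinearMap.congr_fun (hN.2 X hX (f ∘ₗ g)) x

/-- The largest torsion submodule. -/
theorem exists_torsion_submodule [IsNoetherianRing Λ] (hC : IsTorsionClass Λ C)
    (M : ModuleCat.{0} Λ) [Module.Finite Λ M] :
    ∃ U : Submodule Λ M, ModuleCat.of Λ ↥U ∈ C ∧ ModuleCat.of Λ (M ⧸ U) ∈ rPerp Λ C := by
  obtain ⟨U, hU, hmax⟩ := set_has_maximal_iff_noetherian.2
    (inferInstance : IsNoetherian Λ M) {U : Submodule Λ M | ModuleCat.of Λ ↥U ∈ C}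
    ⟨⊥, hC.2.2.1 _ (inferInstanceAs (Subsingleton (⊥ : Submodule Λ M)))⟩
  refine ⟨U, hU, (inferInstance : Module.Finite Λ (M ⧸ U)), fun X hX h => ?_⟩
  change X →ₗ[Λ] (M ⧸ U) at h
  have hr := hC.range_mem (N := ModuleCat.of Λ (M ⧸ U)) hX h
  set V := (LinearMap.range h).comap U.mkQ with hV
  have hUV : U ≤ V := fun x hx => by
    simp only [hV, Submodule.mem_comap, Submodule.mkQ_apply]
    rw [(Submodule.Quotient.mk_eq_zero U).2 hx]
    exact zero_mem _
  have hVC : ModuleCat.of Λ ↥V ∈ C := by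
    refine hC.ext_mem (M := ModuleCat.of Λ ↥V) hU hr (Submodule.inclusion hUV)
      (U.mkQ.restrict (p := V) (q := LinearMap.range h) fun x hx => hx)
      (Submodule.inclusion_injective hUV) ?_ ?_
    · rintro ⟨y, hy⟩
      obtain ⟨x, rfl⟩ := U.mkQ_surjective y
      exact ⟨⟨x, hy⟩, rfl⟩
    · ext ⟨x, hx⟩
      simp [Submodule.range_inclusion, LinearMap.restrict_apply]
  have hVU : V = U := (eq_or_lt_of_le hUV).elim Eq.symm fun hlt => (hmax V hVC hlt).elim
  refine LinearMap.ext fun x => ?_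
  obtain ⟨y, hy⟩ := U.mkQ_surjective (h x)
  have : y ∈ V := by rw [hV, Submodule.mem_comap, hy]; exact ⟨x, rfl⟩
  rw [hVU] at this
  rw [← hy]
  exact (Submodule.Quotient.mk_eq_zero U).2 this

theorem lPerp_rPerp_subset [IsNoetherianRing Λ] (hC : IsTorsionClass Λ C) :
    lPerp Λ (rPerp Λ C) ⊆ C := by
  intro M hM
  have : Module.Finite Λ M := hM.1
  obtain ⟨U, hU, hF⟩ := exists_torsion_submodule hC M
  have h0 : U.mkQ = 0 := hM.2 _ hF U.mkQ
  have hU1 : U = ⊤ := by rw [← U.ker_mkQ, h0, LinearMap.ker_zero]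
  subst hU1
  exact hC.2.1 ⟨Submodule.topEquiv⟩ hU

end TorsionClasses

section CoextendingModules

variable {Λ} {C : Set (ModuleCat.{0} Λ)} {F : Set (ModuleCat.{0} Λ)}

theorem IsMinCoext.mem [IsNoetherianRing Λ] (hC : IsTorsionClass Λ C) {M : ModuleCat.{0} Λ}
    (hM : IsMinCoext Λ (rPerp Λ C) M) : M ∈ C :=
  lPerp_rPerp_subset hC ⟨hM.1, hM.2.2.2.2⟩

theorem IsMinCoext.of_equiv (hF : IsoClosed Λ F) {M N : ModuleCat.{0} Λ} (e : M ≃ₗ[Λ] N)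
    (hM : IsMinCoext Λ F M) : IsMinCoext Λ F N := by
  obtain ⟨h1, h2, h3, h4, h5⟩ := hM
  refine ⟨Module.Finite.equiv e, e.symm.toEquiv.nontrivial, fun S hS => ?_, ?_, fun Y hY f => ?_⟩
  · refine hF ⟨e.submoduleMap (S.comap e.toLinearMap) ≪≫ₗ LinearEquiv.ofEq _ _
      (Submodule.map_comap_eq_of_surjective e.surjective S)⟩ (h3 (S.comap e.toLinearMap) ?_)
    intro h
    apply hS
    rw [← Submodule.map_comap_eq_of_surjective (f := e.toLinearMap) e.surjective S, h,
      Submodule.map_top, LinearMap.range_eq_top]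
    exact e.surjective
  · intro X F' f g hf hg hfg hF' hs
    refine h4 X F' f (e.symm.toLinearMap ∘ₗ g) hf (e.symm.surjective.comp hg) ?_ hF' ?_
    · rw [hfg, LinearEquiv.ker_comp]
    · rintro ⟨s, hs'⟩
      refine hs ⟨s ∘ₗ e.symm.toLinearMap, LinearMap.ext fun x => e.symm.injective ?_⟩
      exact LinearMap.congr_fun hs' (e.symm x)
  · have := h5 Y hY (f ∘ₗ e.toLinearMap)
    refine LinearMap.ext fun x => ?_
    simpa using LinearMap.congr_fun this (e.symm x)

/-- Nonzero morphisms from a module left orthogonal to `F` are surjective onto any minimal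
co-extending module. -/
theorem IsMinCoext.surjective {M N : ModuleCat.{0} Λ}
    (hM : ∀ Y ∈ F, ∀ f : M →ₗ[Λ] Y, f = 0) (hN : IsMinCoext Λ F N) {f : M →ₗ[Λ] N}
    (hf : f ≠ 0) : Surjective f := by
  by_contra hs
  rw [← LinearMap.range_eq_top] at hs
  have h0 : f.rangeRestrict = 0 := hM _ (hN.2.2.1 _ hs) f.rangeRestrict
  exact hf (by rw [← LinearMap.subtype_comp_codRestrict (f := f) (p := LinearMap.range f)
    (fun x => ⟨x, rfl⟩)]; exact (congrArg (fun g => (LinearMap.range f).subtype ∘ₗ g) h0))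

theorem IsMinCoext.isBrick [IsNoetherianRing Λ] {M : ModuleCat.{0} Λ} (hM : IsMinCoext Λ F M) :
    IsBrick Λ M := by
  have : Module.Finite Λ M := hM.1
  exact ⟨hM.1, hM.2.1, fun f hf => IsNoetherian.bijective_of_surjective_endomorphism f
    (IsMinCoext.surjective hM.2.2.2.2 hM hf)⟩

/-- A morphism from a brick onto a minimal co-extending module whose kernel lies in `F` is
injective as soon as the brick is left orthogonal to `F`. -/
theorem IsMinCoext.injective_of_brick {M N : ModuleCat.{0} Λ} (hM : IsBrick Λ M)
    (hMF : ∀ Y ∈ F, ∀ f : M →ₗ[Λ] Y, f = 0) (hN : IsMinCoext Λ F N) {f : M →ₗ[Λ] N}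
    (hf : Surjective f) (hk : ModuleCat.of Λ ↥(LinearMap.ker f) ∈ F) : Injective f := by
  have := hM.2.1
  have := hN.2.1
  have hs : ∃ s : N →ₗ[Λ] M, f ∘ₗ s = LinearMap.id := by
    by_contra hs
    have h := hMF M (hN.2.2.2.1 M _ (LinearMap.ker f).subtype f (Submodule.subtype_injective _) hf
      (Submodule.range_subtype _) hk hs) LinearMap.id
    obtain ⟨x, hx⟩ := exists_ne (0 : M)
    exact hx (LinearMap.congr_fun h x)
  obtain ⟨s, hs⟩ := hs
  have hne : s ∘ₗ f ≠ 0 := fun h => by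
    obtain ⟨x, hx⟩ := exists_ne (0 : N)
    obtain ⟨y, rfl⟩ := hf x
    have h1 : s (f y) = 0 := LinearMap.congr_fun h y
    have h2 : f (s (f y)) = f y := LinearMap.congr_fun hs (f y)
    rw [h1, map_zero] at h2
    exact hx h2.symm
  exact Injective.of_comp (f := s) (hM.2.2 _ hne).1

theorem isSemibrick_MCE [IsNoetherianRing Λ] (hF : IsoClosed Λ F) : IsSemibrick Λ (MCE Λ F) := by
  refine ⟨fun M hM => IsMinCoext.isBrick hM, fun M N ⟨e⟩ hM => IsMinCoext.of_equiv hF e hM,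
    fun M hM N hN he f => ?_⟩
  by_contra hf
  have hs := IsMinCoext.surjective hM.2.2.2.2 hN hf
  have hk : ModuleCat.of Λ ↥(LinearMap.ker f) ∈ F :=
    hM.2.2.1 _ fun h => hf (LinearMap.ker_eq_top.1 h)
  exact he.false (LinearEquiv.ofBijective f
    ⟨hN.injective_of_brick (IsMinCoext.isBrick hM) hM.2.2.2.2 hs hk, hs⟩)

theorem isoClosed_rPerp (X : Set (ModuleCat.{0} Λ)) : IsoClosed Λ (rPerp Λ X) := by
  rintro M N ⟨e⟩ hM
  have : Module.Finite Λ M := hM.1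
  refine ⟨Module.Finite.equiv e, fun Y hY f => LinearMap.ext fun x => e.symm.injective ?_⟩
  simpa using LinearMap.congr_fun (hM.2 Y hY (e.symm.toLinearMap ∘ₗ f)) x

theorem IsSemibrick.bijective {S : Set (ModuleCat.{0} Λ)} (hS : IsSemibrick Λ S)
    {M N : ModuleCat.{0} Λ} (hM : M ∈ S) (hN : N ∈ S) {f : M →ₗ[Λ] N} (hf : f ≠ 0) :
    Bijective f := by
  by_cases h : IsEmpty (M ≃ₗ[Λ] N)
  · exact (hf (hS.2.2 M hM N hN h f)).elim
  · obtain ⟨e⟩ := not_isEmpty_iff.1 h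
    have hne : e.symm.toLinearMap ∘ₗ f ≠ 0 := fun h0 => hf (LinearMap.ext fun x =>
      e.symm.injective (by simpa using LinearMap.congr_fun h0 x))
    have hb : Bijective (e.symm ∘ f) := ((hS.1 M hM).2.2 _ hne)
    exact (Bijective.of_comp_iff' e.symm.bijective f).1 hb

theorem IsSemibrick.isMinCoext [IsNoetherianRing Λ] {S : Set (ModuleCat.{0} Λ)}
    (hS : IsSemibrick Λ S) {M : ModuleCat.{0} Λ} (hM : M ∈ S) :
    IsMinCoext Λ (rPerp Λ S) M := by
  have hMf : Module.Finite Λ M := (hS.1 M hM).1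
  refine ⟨hMf, (hS.1 M hM).2.1, fun N hN => ⟨(inferInstance : Module.Finite Λ N),
    fun X hX f => ?_⟩, fun X F' f g hf hg hfg hF' hs => ⟨?_, fun Z hZ h => ?_⟩,
    fun Y hY f => hY.2 M hM f⟩
  · change X →ₗ[Λ] N at f
    by_contra hf
    have hne : N.subtype ∘ₗ f ≠ 0 := fun h0 => hf (LinearMap.ext fun x =>
      N.subtype_injective (LinearMap.congr_fun h0 x))
    refine hN (Submodule.eq_top_iff'.2 fun x => ?_)
    obtain ⟨y, rfl⟩ := (hS.bijective hX hM hne).2 x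
    exact (f y).2
  · exact isTorsionClass_finite.ext_mem hF'.1 hMf f g hf hg hfg
  · by_cases h0 : g ∘ₗ h = 0
    · obtain ⟨k, rfl⟩ := exists_comp_eq_of_range_le hf (h := h) (by
        rw [hfg]
        rintro _ ⟨z, rfl⟩
        exact LinearMap.congr_fun h0 z)
      rw [hF'.2 Z hZ k, LinearMap.comp_zero]
    · refine (hs ⟨h ∘ₗ (LinearEquiv.ofBijective _ (hS.bijective hZ hM h0)).symm.toLinearMap,
        LinearMap.ext fun x => ?_⟩).elim
      exact (LinearEquiv.ofBijective _ (hS.bijective hZ hM h0)).apply_symm_apply x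

theorem MCE_rPerp_torsClosure [IsNoetherianRing Λ] {S : Set (ModuleCat.{0} Λ)}
    (hS : IsSemibrick Λ S) : MCE Λ (rPerp Λ (torsClosure Λ S)) = S := by
  rw [rPerp_torsClosure fun M hM => (hS.1 M hM).1]
  refine Set.Subset.antisymm (fun M hM => ?_) fun M hM => hS.isMinCoext hM
  have hMF : M ∉ rPerp Λ S := fun h => by
    have := hM.2.1
    obtain ⟨x, hx⟩ := exists_ne (0 : M)
    exact hx (LinearMap.congr_fun (hM.2.2.2.2 M h LinearMap.id) x)
  have : ∃ X ∈ S, ∃ f : X →ₗ[Λ] M, f ≠ 0 := by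
    by_contra! h
    exact hMF ⟨hM.1, h⟩
  obtain ⟨X, hX, f, hf⟩ := this
  have hXF : ∀ Y ∈ rPerp Λ S, ∀ f : X →ₗ[Λ] Y, f = 0 := fun Y hY g => hY.2 X hX g
  have hs := IsMinCoext.surjective hXF hM hf
  have hk := (hS.isMinCoext hX).2.2.1 _ fun h => hf (LinearMap.ker_eq_top.1 h)
  exact hS.2.1 ⟨LinearEquiv.ofBijective f ⟨hM.injective_of_brick (hS.1 X hX) hXF hs hk, hs⟩⟩ hX

end CoextendingModules

section WideSubcategory

variable {Λ} {C : Set (ModuleCat.{0} Λ)}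

/-- Torsion classes are stable under pullback along an epimorphism with torsion kernel. -/
theorem IsTorsionClass.pullback_mem (hC : IsTorsionClass Λ C) {Y X Z : ModuleCat.{0} Λ}
    (hY : Y ∈ C) (g : Y →ₗ[Λ] Z) (q : X →ₗ[Λ] Z) (hq : Surjective q)
    (hk : ModuleCat.of Λ ↥(LinearMap.ker q) ∈ C) :
    ModuleCat.of Λ ↥(LinearMap.ker (g.coprod (-q))) ∈ C := by
  refine hC.ext_mem (M := ModuleCat.of Λ ↥(LinearMap.ker (g.coprod (-q)))) hk hY
    ((LinearMap.inr Λ Y X ∘ₗ (LinearMap.ker q).subtype).codRestrict _ fun x => by simp)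
    (LinearMap.fst Λ Y X ∘ₗ Submodule.subtype _) ?_ ?_ ?_
  · intro x y h
    have := congrArg (fun z => (Subtype.val z).2) h
    exact Subtype.ext this
  · intro y
    obtain ⟨x, hx⟩ := hq (g y)
    exact ⟨⟨(y, x), by simp [hx]⟩, rfl⟩
  · ext ⟨⟨y, x⟩, hx⟩
    constructor
    · rintro ⟨z, hz⟩
      have := congrArg (fun z => (Subtype.val z).1) hz
      exact this.symm
    · intro h
      have hy : y = 0 := h
      subst hy
      exact ⟨⟨x, by simpa using hx⟩, rfl⟩

theorem isWide_alphaOf (hC : IsTorsionClass Λ C) : IsWide Λ (alphaOf Λ C) := by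
  refine ⟨fun M hM => hC.finite hM.1, ?_, ?_, ?_, ?_, ?_⟩
  · rintro M N ⟨e⟩ hM
    refine ⟨hC.2.1 ⟨e⟩ hM.1, fun Y g hY => ?_⟩
    have := hM.2 Y (e.symm.toLinearMap ∘ₗ g) hY
    rwa [LinearEquiv.ker_comp] at this
  · refine fun M h => ⟨hC.2.2.1 M h, fun Y g hY => ?_⟩
    have : LinearMap.ker g = ⊤ := by ext; simp [Subsingleton.elim _ (0 : M)]
    exact hC.2.1 ⟨(LinearEquiv.ofEq _ _ this ≪≫ₗ Submodule.topEquiv).symm⟩ hY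
  · refine fun M N f hM hN => ⟨hN.2 M f hM.1, fun Y g hY => ?_⟩
    change Y →ₗ[Λ] LinearMap.ker f at g
    have := hM.2 Y ((LinearMap.ker f).subtype ∘ₗ g) hY
    rwa [LinearMap.ker_comp_of_ker_eq_bot _ (Submodule.ker_subtype _)] at this
  · intro M N f hM hN
    refine ⟨hC.of_surjective (N := ModuleCat.of Λ (N ⧸ LinearMap.range f)) hN.1
      (LinearMap.range f).mkQ (Submodule.mkQ_surjective _), fun Y g hY => ?_⟩
    have hk : ModuleCat.of Λ ↥(LinearMap.ker (LinearMap.range f).mkQ) ∈ C := by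
      rw [Submodule.ker_mkQ]
      exact hC.range_mem hM.1 f
    have hP := hC.pullback_mem (Z := ModuleCat.of Λ (N ⧸ LinearMap.range f)) hY g
      (LinearMap.range f).mkQ (Submodule.mkQ_surjective _) hk
    set P := LinearMap.ker (g.coprod (-(LinearMap.range f).mkQ))
    have hK := hN.2 _ (LinearMap.snd Λ Y N ∘ₗ P.subtype) hP
    refine hC.of_surjective (N := ModuleCat.of Λ ↥(LinearMap.ker g)) hK
      ((LinearMap.fst Λ Y N ∘ₗ P.subtype ∘ₗ Submodule.subtype _).codRestrict _ ?_) ?_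
    · rintro ⟨⟨⟨y, x⟩, hp⟩, hx⟩
      have hx' : x = 0 := hx
      subst hx'
      simpa [P] using hp
    · rintro ⟨y, hy⟩
      exact ⟨⟨⟨(y, 0), by simpa [P] using hy⟩, rfl⟩, rfl⟩
  · intro A M B f g hf hg hfg hA hB
    refine ⟨hC.ext_mem hA.1 hB.1 f g hf hg hfg, fun Y h hY => ?_⟩
    have hY' := hB.2 Y (g ∘ₗ h) hY
    obtain ⟨k, hk⟩ := exists_comp_eq_of_range_le hf
      (h := h ∘ₗ (LinearMap.ker (g ∘ₗ h)).subtype) (by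
        rw [hfg]
        rintro _ ⟨⟨z, hz⟩, rfl⟩
        exact hz)
    have hk' : ∀ z, f (k z) = h z.1 := fun z => LinearMap.congr_fun hk z
    refine hC.of_surjective (N := ModuleCat.of Λ ↥(LinearMap.ker h)) (hA.2 _ k hY')
      (((LinearMap.ker (g ∘ₗ h)).subtype ∘ₗ (LinearMap.ker k).subtype).codRestrict _ ?_) ?_
    · rintro ⟨z, hz⟩
      have hz' : k z = 0 := hz
      have := hk' z
      rw [hz', map_zero] at this
      exact this.symm
    · rintro ⟨y, hy⟩
      have hy' : h y = 0 := hy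
      have hy2 : y ∈ LinearMap.ker (g ∘ₗ h) := by simp [hy']
      refine ⟨⟨⟨y, hy2⟩, hf ?_⟩, rfl⟩
      rw [map_zero]
      exact (hk' ⟨y, hy2⟩).trans hy'

theorem MCE_subset_alphaOf [IsNoetherianRing Λ] (hC : IsTorsionClass Λ C) :
    MCE Λ (rPerp Λ C) ⊆ alphaOf Λ C := by
  intro X hX
  refine ⟨IsMinCoext.mem hC hX, fun Y g hY => ?_⟩
  have hYf : Module.Finite Λ Y := hC.finite hY
  by_cases hg0 : g = 0
  · have : LinearMap.ker g = ⊤ := LinearMap.ker_eq_top.2 hg0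
    exact hC.2.1 ⟨(LinearEquiv.ofEq _ _ this ≪≫ₗ Submodule.topEquiv).symm⟩ hY
  have hg := IsMinCoext.surjective (fun Z hZ f => hZ.2 Y hY f) hX hg0
  set K := LinearMap.ker g
  obtain ⟨U, hU, hKU⟩ : ∃ U : Submodule Λ K, ModuleCat.of Λ ↥U ∈ C ∧
      ModuleCat.of Λ (K ⧸ U) ∈ rPerp Λ C := exists_torsion_submodule hC (ModuleCat.of Λ ↥K)
  set V : Submodule Λ Y := U.map K.subtype
  have hVK : V ≤ K := Submodule.map_subtype_le K U
  have hUV : V.comap K.subtype = U :=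
    Submodule.comap_map_eq_of_injective K.subtype_injective U
  let f' : (K ⧸ U) →ₗ[Λ] (Y ⧸ V) := U.mapQ V K.subtype hUV.ge
  let g' : (Y ⧸ V) →ₗ[Λ] X := V.liftQ g hVK
  have hf' : Injective f' := by
    rw [← LinearMap.ker_eq_bot, Submodule.ker_mapQ, hUV, Submodule.mkQ_map_self]
  have hg' : Surjective g' := fun x => by
    obtain ⟨y, rfl⟩ := hg x
    exact ⟨V.mkQ y, rfl⟩
  have hfg : LinearMap.range f' = LinearMap.ker g' := by
    rw [Submodule.range_mapQ, Submodule.ker_liftQ, Submodule.range_subtype]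
  have hs : ∃ s : X →ₗ[Λ] (Y ⧸ V), g' ∘ₗ s = LinearMap.id := by
    by_contra hs
    have hF := hX.2.2.2.1 (ModuleCat.of Λ (Y ⧸ V)) _ f' g' hf' hg' hfg hKU hs
    have h0 : V.mkQ = 0 := hF.2 Y hY V.mkQ
    exact hg0 (by rw [← V.liftQ_mkQ g hVK, h0, LinearMap.comp_zero])
  obtain ⟨s, hs⟩ := hs
  obtain ⟨r, hr⟩ := exists_retraction_of_section hf' hfg hs
  have h0 : r ∘ₗ V.mkQ = 0 := hKU.2 Y hY (r ∘ₗ V.mkQ)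
  have hU1 : U = ⊤ := by
    refine Submodule.eq_top_iff'.2 fun x => ?_
    rw [← Submodule.Quotient.mk_eq_zero U]
    have h1 : r (f' (U.mkQ x)) = U.mkQ x := LinearMap.congr_fun hr _
    exact h1.symm.trans (LinearMap.congr_fun h0 x.1)
  rw [hU1] at hU
  exact hC.2.1 ⟨Submodule.topEquiv⟩ hU

end WideSubcategory

section FinitelyGenerated

variable {Λ} {C : Set (ModuleCat.{0} Λ)}

/-- A torsion class maximal among those properly contained in `T` admits a minimal co-extending
module for `rPerp T` outside of it. -/
theorem exists_isMinCoext_notMem [IsNoetherianRing Λ] [IsArtinianRing Λ]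
    {T : Set (ModuleCat.{0} Λ)} (hT : IsTorsionClass Λ T) (hC : IsTorsionClass Λ C)
    {M : ModuleCat.{0} Λ} (hMT : M ∈ T) (hMC : M ∉ C)
    (hmax : ∀ N ∈ T, N ∉ C → torsClosure Λ (insert N C) = T) :
    ∃ N, IsMinCoext Λ (rPerp Λ T) N ∧ N ∉ C := by
  have hMf : Module.Finite Λ M := hT.finite hMT
  obtain ⟨U, hU, hMU⟩ := exists_torsion_submodule hC M
  have hQT : ModuleCat.of Λ (M ⧸ U) ∈ T :=
    hT.of_surjective (N := ModuleCat.of Λ (M ⧸ U)) hMT U.mkQ U.mkQ_surjective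
  have hne : (⊤ : Submodule Λ (M ⧸ U)) ≠ ⊥ := fun h => by
    have hU1 : U = ⊤ := by
      rw [← U.ker_mkQ, LinearMap.ker_eq_top]
      ext x
      exact (Submodule.mem_bot Λ).1 (h ▸ Submodule.mem_top)
    rw [hU1] at hU
    exact hMC (hC.2.1 ⟨Submodule.topEquiv⟩ hU)
  have : IsArtinian Λ (M ⧸ U) := isArtinian_of_fg_of_artinian'
  obtain ⟨N, ⟨hNT, hN0⟩, hmin⟩ := set_has_minimal_iff_artinian.2 this
    {N : Submodule Λ (M ⧸ U) | ModuleCat.of Λ ↥N ∈ T ∧ N ≠ ⊥}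
    ⟨⊤, hT.2.1 ⟨Submodule.topEquiv.symm⟩ hQT, hne⟩
  have hNf : Module.Finite Λ N := hT.finite hNT
  have hNC : ModuleCat.of Λ ↥N ∈ rPerp Λ C :=
    rPerp_of_injective (M := ModuleCat.of Λ ↥N) hMU N.subtype N.subtype_injective
  have hNnt : Nontrivial N := Submodule.nontrivial_iff_ne_bot.2 hN0
  have hN_notMem : ModuleCat.of Λ ↥N ∉ C := fun h => by
    obtain ⟨x, hx⟩ := exists_ne (0 : N)
    exact hx (LinearMap.congr_fun (hNC.2 _ h (LinearMap.id : N →ₗ[Λ] N)) x)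
  have hsub : ∀ S : Submodule Λ N, S ≠ ⊤ → ModuleCat.of Λ ↥S ∈ rPerp Λ T := by
    refine fun S hS => ⟨(inferInstance : Module.Finite Λ S), fun X hX f => ?_⟩
    change X →ₗ[Λ] S at f
    by_contra hf
    let h : X →ₗ[Λ] (M ⧸ U) := N.subtype ∘ₗ S.subtype ∘ₗ f
    refine hmin (LinearMap.range h) ⟨hT.range_mem (N := ModuleCat.of Λ (M ⧸ U)) hX h, ?_⟩ ?_
    · rw [Ne, LinearMap.range_eq_bot]
      exact fun h0 => hf (LinearMap.ext fun x =>
        S.subtype_injective (N.subtype_injective (LinearMap.congr_fun h0 x)))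
    · refine lt_of_le_of_lt (b := S.map N.subtype) ?_ ?_
      · rintro _ ⟨x, rfl⟩
        exact ⟨(f x).1, (f x).2, rfl⟩
      · refine lt_of_le_of_ne (Submodule.map_subtype_le N S) fun h => hS ?_
        rw [← Submodule.comap_map_eq_of_injective N.subtype_injective S, h,
          Submodule.comap_subtype_self]
  refine ⟨ModuleCat.of Λ ↥N, ⟨hNf, hNnt, hsub, ?_, fun Y hY f => hY.2 _ hNT f⟩, hN_notMem⟩
  intro X F' f g hf hg hfg hF' hs
  have hXf : Module.Finite Λ X := isTorsionClass_finite.ext_mem hF'.1 hNf f g hf hg hfg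
  have hF : rPerp Λ T = rPerp Λ (insert (ModuleCat.of Λ ↥N) C) := by
    have hfg : ∀ Z ∈ insert (ModuleCat.of Λ ↥N) C, FG Λ Z := by
      rintro Z (rfl | hZ)
      exacts [hNf, hC.finite hZ]
    rw [← rPerp_torsClosure hfg, hmax _ hNT hN_notMem]
  have hCT : C ⊆ T := by
    rw [← hmax _ hNT hN_notMem]
    exact (Set.subset_insert _ _).trans (subset_torsClosure _)
  have hfactor : ∀ Z ∈ T, ∀ h : Z →ₗ[Λ] X, g ∘ₗ h = 0 → h = 0 := by
    intro Z hZ h h0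
    obtain ⟨k, rfl⟩ := exists_comp_eq_of_range_le hf (h := h) (by
      rw [hfg]
      rintro _ ⟨z, rfl⟩
      exact LinearMap.congr_fun h0 z)
    rw [hF'.2 Z hZ k, LinearMap.comp_zero]
  rw [hF]
  refine ⟨hXf, ?_⟩
  rintro Z (rfl | hZ) h
  · by_contra hne
    change N →ₗ[Λ] X at h
    change X →ₗ[Λ] N at g
    have hgh : g ∘ₗ h ≠ 0 := fun h0 => hne (hfactor _ hNT h h0)
    have hsurj : Surjective (g ∘ₗ h) := by
      rw [← LinearMap.range_eq_top]
      by_contra hr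
      have h0 : (g ∘ₗ h).rangeRestrict = 0 := (hsub _ hr).2 _ hNT (g ∘ₗ h).rangeRestrict
      exact hgh (LinearMap.ext fun x => congrArg Subtype.val (LinearMap.congr_fun h0 x))
    let e := LinearEquiv.ofBijective (g ∘ₗ h)
      (IsNoetherian.bijective_of_surjective_endomorphism _ hsurj)
    exact hs ⟨h ∘ₗ e.symm.toLinearMap, LinearMap.ext fun x => e.apply_symm_apply x⟩
  · exact hfactor Z (hCT hZ) h (hNC.2 Z hZ (g ∘ₗ h))

theorem torsClosure_MCE [IsNoetherianRing Λ] [IsArtinianRing Λ] {T : Set (ModuleCat.{0} Λ)}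
    (hT : IsFinGenTors Λ T) : torsClosure Λ (MCE Λ (rPerp Λ T)) = T := by
  obtain ⟨hTT, M, hM, hTM⟩ := hT
  have hsub : torsClosure Λ (MCE Λ (rPerp Λ T)) ⊆ T :=
    torsClosure_subset hTT fun N hN => IsMinCoext.mem hTT hN
  have hMT : M ∈ T := hTM ▸ subset_torsClosure {M} rfl
  refine hsub.antisymm ?_
  by_contra hne
  have htc : IsTorsionClass Λ (torsClosure Λ (MCE Λ (rPerp Λ T))) :=
    isTorsionClass_torsClosure fun N hN => hN.1
  have hgen : ∀ D, IsTorsionClass Λ D → M ∈ D → T ⊆ D := fun D hD h =>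
    hTM ▸ torsClosure_subset hD (Set.singleton_subset_iff.2 h)
  obtain ⟨D, hSD, hD⟩ := zorn_subset_nonempty
    {D | IsTorsionClass Λ D ∧ D ⊆ T ∧ M ∉ D} (fun c hc hchain hcne =>
      ⟨⋃₀ c, ⟨isTorsionClass_sUnion (fun D hD => (hc hD).1) hchain.directedOn hcne,
        Set.sUnion_subset fun D hD => (hc hD).2.1,
        fun ⟨D, hD, h⟩ => (hc hD).2.2 h⟩, fun _ => Set.subset_sUnion_of_mem⟩)
    (torsClosure Λ (MCE Λ (rPerp Λ T))) ⟨htc, hsub, fun h => hne (hgen _ htc h)⟩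
  obtain ⟨hDt, hDT, hMD⟩ := hD.prop
  obtain ⟨N, hN, hND⟩ := exists_isMinCoext_notMem hTT hDt hMT hMD fun N hNT hND => by
    have hle : torsClosure Λ (insert N D) ⊆ T :=
      torsClosure_subset hTT (Set.insert_subset hNT hDT)
    have htor : IsTorsionClass Λ (torsClosure Λ (insert N D)) :=
      isTorsionClass_torsClosure fun X hX => hTT.finite (Set.insert_subset hNT hDT hX)
    refine hle.antisymm (hgen _ htor ?_)
    by_contra hMn
    exact hND (hD.le_of_ge (y := torsClosure Λ (insert N D)) ⟨htor, hle, hMn⟩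
      ((Set.subset_insert _ _).trans (subset_torsClosure _))
      (subset_torsClosure _ (Set.mem_insert _ _)))
  exact hND (hSD (subset_torsClosure _ hN))

/-- Every module of a generated torsion class lies in one generated by finitely many of the
generators. -/
theorem exists_finite_mem_torsClosure {X : Set (ModuleCat.{0} Λ)} (hX : ∀ M ∈ X, FG Λ M)
    {M : ModuleCat.{0} Λ} (hM : M ∈ torsClosure Λ X) :
    ∃ B ⊆ X, B.Finite ∧ M ∈ torsClosure Λ B := by
  have hU : IsTorsionClass Λ (⋃₀ {D | ∃ B ⊆ X, B.Finite ∧ D = torsClosure Λ B}) := by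
    refine isTorsionClass_sUnion ?_ ?_ ⟨_, ∅, Set.empty_subset _, Set.finite_empty, rfl⟩
    · rintro _ ⟨B, hB, -, rfl⟩
      exact isTorsionClass_torsClosure fun N hN => hX N (hB hN)
    · rintro _ ⟨B, hB, hBf, rfl⟩ _ ⟨B', hB', hBf', rfl⟩
      exact ⟨_, ⟨B ∪ B', Set.union_subset hB hB', hBf.union hBf', rfl⟩,
        torsClosure_mono Set.subset_union_left, torsClosure_mono Set.subset_union_right⟩
  obtain ⟨_, ⟨B, hB, hBf, rfl⟩, hMB⟩ := torsClosure_subset hU (fun N hN =>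
    ⟨_, ⟨{N}, Set.singleton_subset_iff.2 hN, Set.finite_singleton N, rfl⟩,
      subset_torsClosure {N} rfl⟩) hM
  exact ⟨B, hB, hBf, hMB⟩

theorem finiteUpToIso_MCE [IsNoetherianRing Λ] [IsArtinianRing Λ] {T : Set (ModuleCat.{0} Λ)}
    (hT : IsFinGenTors Λ T) : FiniteUpToIso Λ (MCE Λ (rPerp Λ T)) := by
  have hgen := torsClosure_MCE hT
  obtain ⟨hTT, M, hM, hTM⟩ := hT
  have hS := isSemibrick_MCE (isoClosed_rPerp T)
  have hMS : M ∈ torsClosure Λ (MCE Λ (rPerp Λ T)) := by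
    rw [hgen, hTM]; exact subset_torsClosure {M} rfl
  obtain ⟨B, hB, hBf, hMB⟩ := exists_finite_mem_torsClosure (fun N hN => hN.1) hMS
  set S : Set (ModuleCat.{0} Λ) := {N | ∃ N' ∈ B, Nonempty (N ≃ₗ[Λ] N')}
  have hBS : B ⊆ S := fun N hN => ⟨N, hN, ⟨LinearEquiv.refl Λ N⟩⟩
  have hSM : S ⊆ MCE Λ (rPerp Λ T) := by
    rintro N ⟨N', hN', ⟨e⟩⟩
    exact hS.2.1 ⟨e.symm⟩ (hB hN')
  have hSs : IsSemibrick Λ S := by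
    refine ⟨fun N hN => hS.1 N (hSM hN), ?_, fun N hN N' hN' => hS.2.2 N (hSM hN) N' (hSM hN')⟩
    rintro N N' ⟨e⟩ ⟨N'', hN'', ⟨e'⟩⟩
    exact ⟨N'', hN'', ⟨e.symm ≪≫ₗ e'⟩⟩
  have hTS : torsClosure Λ S = T := by
    refine ((torsClosure_mono hSM).trans hgen.le).antisymm ?_
    rw [hTM]
    exact torsClosure_subset (isTorsionClass_torsClosure fun N hN => (hSs.1 N hN).1)
      (Set.singleton_subset_iff.2 (torsClosure_mono hBS hMB))
  refine ⟨B, hBf, fun N hN => ?_⟩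
  rw [← hTS, MCE_rPerp_torsClosure hSs] at hN
  exact hN

theorem exists_torsClosure_singleton {B : Set (ModuleCat.{0} Λ)} (hB : B.Finite)
    (hfg : ∀ M ∈ B, FG Λ M) :
    ∃ M : ModuleCat.{0} Λ, FG Λ M ∧ torsClosure Λ B = torsClosure Λ {M} := by
  suffices h : ∃ M : ModuleCat.{0} Λ, M ∈ torsClosure Λ B ∧
      ∀ N ∈ B, ∃ f : M →ₗ[Λ] N, Surjective f by
    obtain ⟨M, hM, hMB⟩ := h
    have hMf : FG Λ M := (isTorsionClass_torsClosure hfg).finite hM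
    have hMs : ∀ N ∈ ({M} : Set (ModuleCat.{0} Λ)), FG Λ N := by rintro _ rfl; exact hMf
    refine ⟨M, hMf, torsClosure_eq_of_subset hfg hMs (fun N hN => ?_)
      (Set.singleton_subset_iff.2 hM)⟩
    obtain ⟨f, hf⟩ := hMB N hN
    exact (isTorsionClass_torsClosure hMs).of_surjective (subset_torsClosure {M} rfl) f hf
  induction B, hB using Set.Finite.induction_on with
  | empty =>
    exact ⟨ModuleCat.of Λ PUnit, fun D hD => hD.1.2.2.1 _ (inferInstanceAs (Subsingleton PUnit)),
      fun N hN => hN.elim⟩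
  | @insert N B _ _ ih =>
    obtain ⟨M, hM, hMB⟩ := ih fun X hX => hfg X (Set.mem_insert_of_mem _ hX)
    refine ⟨ModuleCat.of Λ (N × M), (isTorsionClass_torsClosure hfg).prod_mem
      (subset_torsClosure _ (Set.mem_insert _ _)) (torsClosure_mono (Set.subset_insert _ _) hM), ?_⟩
    rintro X (rfl | hX)
    · exact ⟨LinearMap.fst Λ _ _, Prod.fst_surjective⟩
    · obtain ⟨f, hf⟩ := hMB X hX
      exact ⟨f ∘ₗ LinearMap.snd Λ _ _, hf.comp Prod.snd_surjective⟩

theorem isFinGenTors_torsClosure {S : Set (ModuleCat.{0} Λ)} (hfg : ∀ M ∈ S, FG Λ M)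
    (hiso : IsoClosed Λ S) (hS : FiniteUpToIso Λ S) : IsFinGenTors Λ (torsClosure Λ S) := by
  obtain ⟨B, hB, hSB⟩ := hS
  refine ⟨isTorsionClass_torsClosure hfg, ?_⟩
  have hfg' : ∀ M ∈ B ∩ S, FG Λ M := fun M hM => hfg M hM.2
  obtain ⟨M, hM, h⟩ := exists_torsClosure_singleton (hB.inter_of_left S) hfg'
  refine ⟨M, hM, h ▸ torsClosure_eq_of_subset hfg hfg' (fun N hN => ?_)
    fun N hN => subset_torsClosure S hN.2⟩
  obtain ⟨N', hN', ⟨e⟩⟩ := hSB N hN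
  exact (isTorsionClass_torsClosure hfg').2.1 ⟨e.symm⟩
    (subset_torsClosure _ ⟨hN', hiso ⟨e⟩ hN⟩)

end FinitelyGenerated

/-- Every finitely generated torsion class in `mod Λ` is widely generated, and
the bijections `T ↦ MCE(T^⊥)`, `S ↦ T(S)` restrict to mutually inverse bijections between
finitely generated torsion classes and finite semibricks. -/
theorem finGen_torsion_classes_biject_with_finite_semibricks
    (K Λ : Type) [Field K] [Ring Λ] [Algebra K Λ] [FiniteDimensional K Λ] :
    (∀ T, IsFinGenTors Λ T → IsWidelyGenTors Λ T) ∧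
    (∀ T, IsFinGenTors Λ T → IsSemibrick Λ (MCE Λ (rPerp Λ T)) ∧
        FiniteUpToIso Λ (MCE Λ (rPerp Λ T)) ∧ torsClosure Λ (MCE Λ (rPerp Λ T)) = T) ∧
    (∀ S, IsSemibrick Λ S → FiniteUpToIso Λ S →
        IsFinGenTors Λ (torsClosure Λ S) ∧ MCE Λ (rPerp Λ (torsClosure Λ S)) = S) := by
  have : IsNoetherianRing Λ := isNoetherian_of_tower K inferInstance
  have : IsArtinianRing Λ := isArtinian_of_tower K inferInstance
  refine ⟨fun T hT => ⟨hT.1, alphaOf Λ T, isWide_alphaOf hT.1, ?_⟩, fun T hT =>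
    ⟨isSemibrick_MCE (isoClosed_rPerp T), finiteUpToIso_MCE hT, torsClosure_MCE hT⟩,
    fun S hS hSf => ⟨isFinGenTors_torsClosure (fun M hM => (hS.1 M hM).1) hS.2.1 hSf,
      MCE_rPerp_torsClosure hS⟩⟩
  refine Set.Subset.antisymm ?_ (torsClosure_subset hT.1 fun M hM => hM.1)
  exact (torsClosure_MCE hT).ge.trans (torsClosure_mono (MCE_subset_alphaOf hT.1))

end BrickPaper
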